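/- Let (f, u) be a framed knot: f : ℝ → ℝ³ a C^∞ embedding of period L parametrized by arc length, and u : ℝ → ℝ³ a C^∞ map of period L with |u(s)| = 1 and u(s)·f'(s) = 0 for all s. Then there exists ε₀ > 0 such that for all ε with 0 < ε < ε₀, setting g_ε(t) = f(t) + ε·u(t), the curve g_ε is disjoint from f, and the Gauss linking integral Lk(f, g_ε) = (1/4π) ∫₀^L ∫₀^L det(f'(s), g_ε'(t), f(s) − g_ε(t)) / |f(s) − g_ε(t)|³ ds dt satisfies Lk(f, g_ε) = Wr(f) + Tw(f, u); in particular Wr(f) + Tw(f, u) is an integer (equal to the linking number of the two components of the ribbon). -/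

import Mathlib

noncomputable section
open Real

/-- Euclidean 3-space. -/
abbrev E3 : Type := EuclideanSpace ℝ (Fin 3)

/-- The dot product of two vectors in `E3`. -/
def dot3 (u v : E3) : ℝ := u 0 * v 0 + u 1 * v 1 + u 2 * v 2

/-- The cross product of two vectors in `E3`. -/
def cross3 (u v : E3) : E3 :=
  (WithLp.equiv 2 (Fin 3 → ℝ)).symm
    ![u 1 * v 2 - u 2 * v 1, u 2 * v 0 - u 0 * v 2, u 0 * v 1 - u 1 * v 0]

/-- The determinant `det(u, v, w)` of three vectors in `E3`. -/
def det3 (u v w : E3) : ℝ := dot3 u (cross3 v w)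

/-- The writhe of a closed curve `g` of period `L`, given by the Gauss integral. -/
def writhe (g : ℝ → E3) (L : ℝ) : ℝ :=
  (1 / (4 * π)) * ∫ s in (0:ℝ)..L, ∫ t in (0:ℝ)..L,
    det3 (deriv g s) (deriv g t) (g s - g t) / ‖g s - g t‖ ^ 3

/-- The inversion in the sphere of center `P` and radius `r`. -/
def inv3 (P : E3) (r : ℝ) (x : E3) : E3 := P + (r ^ 2 / ‖x - P‖ ^ 2) • (x - P)

/-- The differential of the inversion `inv3 P r` at `x`, applied to `v`. -/
def dInv (P : E3) (r : ℝ) (x v : E3) : E3 :=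
  (r ^ 2 / ‖x - P‖ ^ 2) • (v - ((2 * dot3 (x - P) v) / ‖x - P‖ ^ 2) • (x - P))

/-- The total twist of a closed curve `g` of period `L` with unit normal framing `w`. -/
def twist (g w : ℝ → E3) (L : ℝ) : ℝ :=
  (1 / (2 * π)) * ∫ s in (0:ℝ)..L,
    dot3 (deriv w s) (cross3 ((‖deriv g s‖)⁻¹ • deriv g s) (w s))

/-- The principal normal `e₂ = f''/κ` of an arc-length parametrized curve. -/
def e2 (f : ℝ → E3) (s : ℝ) : E3 := (‖deriv (deriv f) s‖)⁻¹ • deriv (deriv f) s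

/-- The binormal `e₃ = e₁ × e₂` of an arc-length parametrized curve. -/
def e3 (f : ℝ → E3) (s : ℝ) : E3 := cross3 (deriv f s) (e2 f s)

/-- The torsion `τ = e₂'·e₃` of an arc-length parametrized curve. -/
def torsionArc (f : ℝ → E3) (s : ℝ) : ℝ := dot3 (deriv (e2 f) s) (e3 f s)

/-- The total torsion `Tω = (1/2π) ∫ τ` of an arc-length parametrized closed curve. -/
def totalTorsionArc (f : ℝ → E3) (L : ℝ) : ℝ :=
  (1 / (2 * π)) * ∫ s in (0:ℝ)..L, torsionArc f s

/-- The torsion `τ_g = det(g', g'', g''')/|g' × g''|²` of a regular curve. -/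
def torsionGen (g : ℝ → E3) (s : ℝ) : ℝ :=
  det3 (deriv g s) (deriv (deriv g) s) (deriv (deriv (deriv g)) s) /
    ‖cross3 (deriv g s) (deriv (deriv g) s)‖ ^ 2

/-- The total torsion `Tω = (1/2π) ∫ τ_g |g'|` of a regular closed curve. -/
def totalTorsionGen (g : ℝ → E3) (L : ℝ) : ℝ :=
  (1 / (2 * π)) * ∫ s in (0:ℝ)..L, torsionGen g s * ‖deriv g s‖

/-- The osculating circle at `s` of an arc-length parametrized curve with `κ(s) > 0`:
the circle of center `f(s) + (1/κ(s)) e₂(s)` and radius `1/κ(s)` in the plane through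
`f(s)` spanned by `e₁(s)` and `e₂(s)`. -/
def osculatingCircleArc (f : ℝ → E3) (s : ℝ) : Set E3 :=
  {y | (∃ a b : ℝ, y = f s + a • deriv f s + b • e2 f s) ∧
    ‖y - (f s + (‖deriv (deriv f) s‖)⁻¹ • e2 f s)‖ = (‖deriv (deriv f) s‖)⁻¹}

/-- The curvature tube of `f`: the union of all osculating circles. -/
def curvatureTube (f : ℝ → E3) : Set E3 := ⋃ s : ℝ, osculatingCircleArc f s

/-- The Gauss linking integral of two disjoint closed curves of period `L`. -/
def linkInt (a b : ℝ → E3) (L : ℝ) : ℝ :=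
  (1 / (4 * π)) * ∫ s in (0:ℝ)..L, ∫ t in (0:ℝ)..L,
    det3 (deriv a s) (deriv b t) (a s - b t) / ‖a s - b t‖ ^ 3

open MeasureTheory Set Filter Topology

section VectorAlgebra

lemma dot3_eq_inner (u v : E3) : dot3 u v = inner ℝ u v := by
  simp only [dot3, PiLp.inner_apply, Fin.sum_univ_three]
  simp
  ring

lemma dot3_self (u : E3) : dot3 u u = ‖u‖ ^ 2 := by
  rw [dot3_eq_inner, real_inner_self_eq_norm_sq]

lemma norm_sq_eq (u : E3) : ‖u‖ ^ 2 = u 0 ^ 2 + u 1 ^ 2 + u 2 ^ 2 := by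
  rw [← dot3_self, dot3]; ring

lemma det3_eq (u v w : E3) : det3 u v w =
    u 0 * (v 1 * w 2 - v 2 * w 1) + u 1 * (v 2 * w 0 - v 0 * w 2)
      + u 2 * (v 0 * w 1 - v 1 * w 0) := by
  simp [det3, dot3, cross3]

lemma Continuous.det3 {X : Type*} [TopologicalSpace X] {u v w : X → E3}
    (hu : Continuous u) (hv : Continuous v) (hw : Continuous w) :
    Continuous fun x => det3 (u x) (v x) (w x) := by
  simp only [det3_eq]
  fun_prop

lemma HasDerivAt.apply_e3 {d : ℝ → E3} {p : E3} {x : ℝ} (h : HasDerivAt d p x) (i : Fin 3) :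
    HasDerivAt (fun y => d y i) (p i) x :=
  (EuclideanSpace.proj (𝕜 := ℝ) i : E3 →L[ℝ] ℝ).hasFDerivAt.comp_hasDerivAt x h

lemma HasDerivAt.dot3_right (v : E3) {d : ℝ → E3} {p : E3} {x : ℝ} (h : HasDerivAt d p x) :
    HasDerivAt (fun y => dot3 v (d y)) (dot3 v p) x :=
  (((h.apply_e3 0).const_mul _).add ((h.apply_e3 1).const_mul _)).add
    ((h.apply_e3 2).const_mul _)

lemma HasDerivAt.det3_middle (v q : E3) {d : ℝ → E3} {p : E3} {x : ℝ} (h : HasDerivAt d p x) :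
    HasDerivAt (fun y => det3 v (d y) q) (det3 v p q) x := by
  simp only [det3_eq]
  have h0 := h.apply_e3 0
  have h1 := h.apply_e3 1
  have h2 := h.apply_e3 2
  exact ((((h1.mul_const _).sub (h2.mul_const _)).const_mul _).add
    (((h2.mul_const _).sub (h0.mul_const _)).const_mul _)).add
    (((h0.mul_const _).sub (h1.mul_const _)).const_mul _)

lemma HasDerivAt.norm_e3 {d : ℝ → E3} {p : E3} {x : ℝ} (h : HasDerivAt d p x) (h0 : d x ≠ 0) :
    HasDerivAt (fun y => ‖d y‖) (dot3 (d x) p / ‖d x‖) x := by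
  have h1 := h.norm_sq.sqrt (by simpa using h0)
  simp only [Real.sqrt_sq (norm_nonneg _)] at h1
  convert h1 using 1
  rw [dot3_eq_inner]
  field_simp

lemma abs_det3_le (u v w : E3) : |det3 u v w| ≤ 6 * (‖u‖ * ‖v‖ * ‖w‖) := by
  have hc : ∀ (z : E3) (i : Fin 3), |z i| ≤ ‖z‖ := fun z i => by
    simpa using PiLp.norm_apply_le z i
  have hm : ∀ i j k : Fin 3, |u i * v j * w k| ≤ ‖u‖ * ‖v‖ * ‖w‖ := fun i j k => by
    rw [abs_mul, abs_mul]
    gcongr <;> exact hc _ _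
  have := hm 0 1 2
  have := hm 0 2 1
  have := hm 1 2 0
  have := hm 1 0 2
  have := hm 2 0 1
  have := hm 2 1 0
  simp only [abs_le] at *
  rw [det3_eq]
  constructor <;> linarith

/-- The Dirac monopole potential with string direction `-v`, at `d`, applied to `q`. -/
def monopole (v d q : E3) : ℝ := det3 v d q / (‖d‖ * (‖d‖ + dot3 v d))

/-- The derivative of `monopole v · q` at `d` in the direction `p`. -/
def monopoleDeriv (v d p q : E3) : ℝ :=
  (det3 v p q * (‖d‖ * (‖d‖ + dot3 v d)) -
    det3 v d q * (dot3 d p / ‖d‖ * (‖d‖ + dot3 v d) + ‖d‖ * (dot3 d p / ‖d‖ + dot3 v p))) /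
    (‖d‖ * (‖d‖ + dot3 v d)) ^ 2

lemma HasDerivAt.monopole (v q : E3) {d : ℝ → E3} {p : E3} {x : ℝ} (h : HasDerivAt d p x)
    (h0 : d x ≠ 0) (h1 : ‖d x‖ + dot3 v (d x) ≠ 0) :
    HasDerivAt (fun y => monopole v (d y) q) (monopoleDeriv v (d x) p q) x :=
  (h.det3_middle v q).div ((h.norm_e3 h0).mul ((h.norm_e3 h0).add (h.dot3_right v)))
    (mul_ne_zero (norm_ne_zero_iff.2 h0) h1)

/-- The curl of the monopole potential is the Coulomb field. -/
lemma monopoleDeriv_sub_swap {v d : E3} (p q : E3) (hv : ‖v‖ = 1) (h0 : d ≠ 0)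
    (h1 : ‖d‖ + dot3 v d ≠ 0) :
    monopoleDeriv v d p q - monopoleDeriv v d q p = det3 d p q / ‖d‖ ^ 3 := by
  have hr : ‖d‖ ≠ 0 := norm_ne_zero_iff.2 h0
  have hv2 : v 0 ^ 2 + v 1 ^ 2 + v 2 ^ 2 = 1 := by rw [← norm_sq_eq, hv]; norm_num
  have hd2 := norm_sq_eq d
  have e1 : det3 v d q * dot3 d p - det3 v d p * dot3 d q
      = det3 v p q * ‖d‖ ^ 2 - dot3 v d * det3 d p q := by
    rw [hd2]; simp only [det3_eq, dot3]; ring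
  have e2 : det3 v d q * dot3 v p - det3 v d p * dot3 v q
      = dot3 v d * det3 v p q - det3 d p q := by
    rw [← one_mul (det3 d p q), ← hv2]; simp only [det3_eq, dot3]; ring
  have e3 : det3 v q p = - det3 v p q := by simp only [det3_eq]; ring
  simp only [monopoleDeriv, e3]
  generalize dot3 v d = vd at *
  generalize ‖d‖ = r at *
  field_simp
  linear_combination (-(r + vd) - r) * e1 - r ^ 2 * e2

/-- Up to scale, the inner product of two spinors polarised along `v` and `w`,
projected to the direction of `d`. -/
def spinorPairing (v w d : E3) : ℂ :=
  ((1 + dot3 v w) * ‖d‖ + dot3 (v + w) d : ℝ) + (det3 v d w : ℝ) * Complex.I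

lemma normSq_spinorPairing {v w : E3} (d : E3) (hv : ‖v‖ = 1) (hw : ‖w‖ = 1) :
    Complex.normSq (spinorPairing v w d) =
      2 * (1 + dot3 v w) * (‖d‖ + dot3 v d) * (‖d‖ + dot3 w d) := by
  have hv2 : v 0 ^ 2 + v 1 ^ 2 + v 2 ^ 2 = 1 := by rw [← norm_sq_eq, hv]; norm_num
  have hw2 : w 0 ^ 2 + w 1 ^ 2 + w 2 ^ 2 = 1 := by rw [← norm_sq_eq, hw]; norm_num
  have hd2 := norm_sq_eq d
  rw [spinorPairing, Complex.normSq_add_mul_I]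
  have e1 : dot3 (v + w) d = dot3 v d + dot3 w d := by simp [dot3]; ring
  have e2 : det3 v d w ^ 2 = ‖d‖ ^ 2 + 2 * dot3 v d * dot3 w d * dot3 v w
      - ‖d‖ ^ 2 * dot3 v w ^ 2 - dot3 v d ^ 2 - dot3 w d ^ 2 := by
    have : det3 v d w ^ 2 = (v 0 ^ 2 + v 1 ^ 2 + v 2 ^ 2) * (w 0 ^ 2 + w 1 ^ 2 + w 2 ^ 2) * ‖d‖ ^ 2
      + 2 * dot3 v d * dot3 w d * dot3 v w
      - ‖d‖ ^ 2 * dot3 v w ^ 2 - (w 0 ^ 2 + w 1 ^ 2 + w 2 ^ 2) * dot3 v d ^ 2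
      - (v 0 ^ 2 + v 1 ^ 2 + v 2 ^ 2) * dot3 w d ^ 2 := by
      rw [hd2]; simp only [det3_eq, dot3]; ring
    rw [this, hv2, hw2]; ring
  rw [e1, e2]
  ring

/-- The derivative of `spinorPairing v w` at `d` in the direction `q`. -/
def spinorPairingDeriv (v w d q : E3) : ℂ :=
  ((1 + dot3 v w) * (dot3 d q / ‖d‖) + dot3 (v + w) q : ℝ) + (det3 v q w : ℝ) * Complex.I

lemma HasDerivAt.spinorPairing (v w : E3) {d : ℝ → E3} {q : E3} {x : ℝ} (h : HasDerivAt d q x)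
    (h0 : d x ≠ 0) :
    HasDerivAt (fun y => spinorPairing v w (d y)) (spinorPairingDeriv v w (d x) q) x :=
  (((h.norm_e3 h0).const_mul _).add (h.dot3_right (v + w))).ofReal_comp.add
    ((h.det3_middle v w).ofReal_comp.mul_const _)

lemma im_spinorPairingDeriv_div {v w d : E3} (q : E3) (hv : ‖v‖ = 1) (hw : ‖w‖ = 1) (h0 : d ≠ 0)
    (hvw : 1 + dot3 v w ≠ 0) (h1 : ‖d‖ + dot3 v d ≠ 0) (h2 : ‖d‖ + dot3 w d ≠ 0) :
    (spinorPairingDeriv v w d q / spinorPairing v w d).im =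
      (monopole w d q - monopole v d q) / 2 := by
  have hr : ‖d‖ ≠ 0 := norm_ne_zero_iff.2 h0
  have hv2 : v 0 ^ 2 + v 1 ^ 2 + v 2 ^ 2 = 1 := by rw [← norm_sq_eq, hv]; norm_num
  have hw2 : w 0 ^ 2 + w 1 ^ 2 + w 2 ^ 2 = 1 := by rw [← norm_sq_eq, hw]; norm_num
  have hd2 := norm_sq_eq d
  have e0 : ‖d‖ ^ 2 * det3 v q w - dot3 d q * det3 v d w
      = dot3 v d * det3 w d q - dot3 w d * det3 v d q := by
    rw [hd2]; simp only [det3_eq, dot3]; ring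
  have e1 : det3 v q w * (dot3 v d + dot3 w d) - det3 v d w * dot3 (v + w) q
      = (1 + dot3 v w) * (det3 w d q - det3 v d q) := by
    have : det3 v q w * (dot3 v d + dot3 w d) - det3 v d w * dot3 (v + w) q
      = (v 0 ^ 2 + v 1 ^ 2 + v 2 ^ 2 + dot3 v w) * det3 w d q
        - (w 0 ^ 2 + w 1 ^ 2 + w 2 ^ 2 + dot3 v w) * det3 v d q := by
      simp only [det3_eq, dot3, PiLp.add_apply]; ring
    rw [this, hv2, hw2]; ring
  have e2 : dot3 (v + w) d = dot3 v d + dot3 w d := by simp [dot3]; ring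
  rw [Complex.div_im, normSq_spinorPairing d hv hw]
  simp only [spinorPairing, spinorPairingDeriv, monopole, Complex.add_im, Complex.add_re,
    Complex.ofReal_re, Complex.ofReal_im, Complex.mul_re, Complex.mul_im, Complex.I_re,
    Complex.I_im, e2]
  generalize dot3 v d = vd at *
  generalize dot3 w d = wd at *
  generalize dot3 v w = vw at *
  generalize dot3 d q = dq at *
  generalize dot3 (v + w) q = vwq at *
  generalize det3 v q w = D1 at *
  generalize det3 v d w = D2 at *
  generalize det3 v d q = D3 at *
  generalize det3 w d q = D4 at *
  generalize ‖d‖ = r at *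
  field_simp
  ring_nf
  linear_combination (1 + vw) * e0 + r * e1

end VectorAlgebra

section LinkingInteger

lemma hasDerivAt_intervalIntegral_of_continuousOn {F F' : ℝ → ℝ → ℝ} {U : Set ℝ} (hU : IsOpen U)
    (a b : ℝ) (hF : ∀ s ∈ U, Continuous (F s))
    (hF' : ContinuousOn (Function.uncurry F') (U ×ˢ univ))
    (hd : ∀ s ∈ U, ∀ t, HasDerivAt (fun x => F x t) (F' s t) s) {s₀ : ℝ} (hs₀ : s₀ ∈ U) :
    HasDerivAt (fun s => ∫ t in a..b, F s t) (∫ t in a..b, F' s₀ t) s₀ := by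
  obtain ⟨K, hK, hKs, hKU⟩ := exists_compact_subset hU hs₀
  obtain ⟨C, hC⟩ := (hK.prod (isCompact_uIcc (a := a) (b := b))).exists_bound_of_continuousOn
    (hF'.mono (prod_mono hKU (subset_univ _)))
  have hcont : Continuous (F' s₀) :=
    hF'.comp_continuous (f := fun t => (s₀, t)) (by fun_prop) fun t => ⟨hs₀, mem_univ _⟩
  refine (intervalIntegral.hasDerivAt_integral_of_dominated_loc_of_deriv_le
    (F' := F') (bound := fun _ => C) (mem_interior_iff_mem_nhds.1 hKs) ?_
    ((hF s₀ hs₀).intervalIntegrable _ _) hcont.aestronglyMeasurable ?_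
    intervalIntegrable_const ?_).2
  · filter_upwards [hU.mem_nhds hs₀] with s hs using (hF s hs).aestronglyMeasurable
  · exact ae_of_all _ fun t ht x hx => hC (x, t) ⟨hx, uIoc_subset_uIcc ht⟩
  · exact ae_of_all _ fun t _ x hx => hd x (hKU hx) t

/-- The winding number of a closed loop in `ℂ \ {0}` is an integer. -/
lemma exists_int_integral_logDeriv_im {F F' : ℝ → ℂ} (hF : ∀ t, HasDerivAt F (F' t) t)
    (hF' : Continuous F') (h0 : ∀ t, F t ≠ 0) {L : ℝ} (hL : F L = F 0) :
    ∃ k : ℤ, ∫ t in (0:ℝ)..L, (F' t / F t).im = 2 * π * k := by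
  have hFc : Continuous F := continuous_iff_continuousAt.2 fun t => (hF t).continuousAt
  have hc : Continuous fun t => F' t / F t := hF'.div hFc h0
  have hI : ∀ x, HasDerivAt (fun x => ∫ t in (0:ℝ)..x, F' t / F t) (F' x / F x) x := fun x =>
    intervalIntegral.integral_hasDerivAt_right (hc.intervalIntegrable _ _)
      (hc.stronglyMeasurableAtFilter _ _) hc.continuousAt
  have hy : ∀ x, HasDerivAt (fun x => F x * Complex.exp (-∫ t in (0:ℝ)..x, F' t / F t)) 0 x := by
    intro x
    refine ((hF x).mul (hI x).neg.cexp).congr_deriv ?_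
    have := h0 x
    field_simp
    ring
  have hconst := is_const_of_deriv_eq_zero (fun x => (hy x).differentiableAt)
    (fun x => (hy x).deriv) L 0
  simp only [intervalIntegral.integral_same, neg_zero, Complex.exp_zero, hL] at hconst
  obtain ⟨n, hn⟩ := Complex.exp_eq_one_iff.1 (mul_left_cancel₀ (h0 0) hconst)
  refine ⟨-n, ?_⟩
  have h1 := Complex.imCLM.intervalIntegral_comp_comm (hc.intervalIntegrable (μ := volume) 0 L)
  simp only [Complex.imCLM_apply] at h1
  rw [h1, neg_eq_iff_eq_neg.1 hn]
  simp
  ring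

/-- Admissible string directions at `x` for the closed curve `b`: unit vectors `v` in a fixed open
half-space such that no ray from a point of `b` in the direction `-v` meets `x`. -/
structure IsStringDir (b : ℝ → E3) (x v : E3) : Prop where
  norm_eq : ‖v‖ = 1
  pos : 0 < v 0
  norm_add_pos : ∀ t, 0 < ‖x - b t‖ + dot3 v (x - b t)

lemma exists_isStringDir {b : ℝ → E3} (hb : ContDiff ℝ 1 b) {x : E3} (hx : ∀ t, x ≠ b t) :
    ∃ v, IsStringDir b x v := by
  have hdense : Dense (range fun p : ℝ × ℝ => p.1 • (x - b p.2))ᶜ := by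
    refine ContDiff.dense_compl_range_of_finrank_lt_finrank (by fun_prop) ?_
    simp
  have hopen : IsOpen {z : E3 | z 0 < 0} := isOpen_lt (by fun_prop) continuous_const
  obtain ⟨w, hw, hw'⟩ := hdense.inter_open_nonempty _ hopen
    ⟨-EuclideanSpace.single 0 1, by simp⟩
  have hw0 : w 0 < 0 := hw
  have hwn : 0 < ‖w‖ := norm_pos_iff.2 fun h => by simp [h] at hw0
  have hvn : ‖-(‖w‖⁻¹ • w)‖ = 1 := by
    rw [norm_neg, norm_smul, norm_inv, norm_norm, inv_mul_cancel₀ hwn.ne']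
  refine ⟨-(‖w‖⁻¹ • w), hvn, ?_, fun t => ?_⟩
  · simp only [PiLp.neg_apply, PiLp.smul_apply, smul_eq_mul]
    have := mul_pos (inv_pos.2 hwn) (neg_pos.2 hw0)
    linarith
  · by_contra hle
    have hd : 0 < ‖x - b t‖ := norm_pos_iff.2 (sub_ne_zero.2 (hx t))
    have h1 : inner ℝ (‖w‖⁻¹ • w) (x - b t) = ‖‖w‖⁻¹ • w‖ * ‖x - b t‖ := by
      rw [norm_neg] at hvn
      refine le_antisymm (real_inner_le_norm _ _) ?_
      rw [dot3_eq_inner, inner_neg_left] at hle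
      rw [hvn]
      linarith
    rw [inner_eq_norm_mul_iff_real, ← norm_neg (‖w‖⁻¹ • w), hvn, one_smul] at h1
    refine hw' ⟨(‖w‖ / ‖x - b t‖, t), ?_⟩
    refine (congrArg ((‖w‖ / ‖x - b t‖) • ·) h1.symm).trans ?_
    simp only [smul_smul, ← mul_assoc]
    rw [div_mul_cancel₀ _ hd.ne', mul_inv_cancel₀ hwn.ne', one_smul]

lemma IsStringDir.one_add_dot3_pos {b : ℝ → E3} {x v w : E3} (hv : IsStringDir b x v)
    (hw : IsStringDir b x w) : 0 < 1 + dot3 v w := by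
  have h1 := norm_sq_eq v
  have h2 := norm_sq_eq w
  rw [hv.norm_eq] at h1
  rw [hw.norm_eq] at h2
  have := hv.pos
  have := hw.pos
  simp only [dot3]
  nlinarith [sq_nonneg (v 1 + w 1), sq_nonneg (v 2 + w 2), sq_pos_of_pos (add_pos hv.pos hw.pos)]

lemma IsStringDir.ne {b : ℝ → E3} {x v : E3} (hv : IsStringDir b x v) (t : ℝ) : x - b t ≠ 0 := by
  intro h
  have := hv.norm_add_pos t
  simp [h, dot3] at this

lemma ContinuousOn.monopole {X : Type*} [TopologicalSpace X] {S : Set X} (v : E3) {d q : X → E3}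
    (hd : ContinuousOn d S) (hq : ContinuousOn q S)
    (h : ∀ x ∈ S, 0 < ‖d x‖ + dot3 v (d x)) :
    ContinuousOn (fun x => monopole v (d x) (q x)) S := by
  have h0 : ∀ x ∈ S, d x ≠ 0 := fun x hx hz => by simpa [hz, dot3] using h x hx
  simp only [_root_.monopole]
  refine ContinuousOn.div ?_ ?_ fun x hx =>
    mul_ne_zero (norm_ne_zero_iff.2 (h0 x hx)) (h x hx).ne'
  · simp only [det3_eq]; fun_prop
  · simp only [dot3]; fun_prop

lemma ContinuousOn.monopoleDeriv {X : Type*} [TopologicalSpace X] {S : Set X} (v : E3)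
    {d p q : X → E3} (hd : ContinuousOn d S) (hp : ContinuousOn p S) (hq : ContinuousOn q S)
    (h : ∀ x ∈ S, 0 < ‖d x‖ + dot3 v (d x)) :
    ContinuousOn (fun x => monopoleDeriv v (d x) (p x) (q x)) S := by
  have h0 : ∀ x ∈ S, ‖d x‖ ≠ 0 := fun x hx hz => by
    simpa [norm_eq_zero.1 hz, dot3] using h x hx
  simp only [_root_.monopoleDeriv]
  refine ContinuousOn.div ?_ ?_ fun x hx =>
    pow_ne_zero _ (mul_ne_zero (h0 x hx) (h x hx).ne')
  · simp only [det3_eq, dot3]; fun_prop (disch := assumption)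
  · simp only [dot3]; fun_prop

/-- The solid angle subtended at `x` by the closed curve `b` of period `L`, relative to the string
direction `v`. -/
def solidAngle (b : ℝ → E3) (L : ℝ) (v x : E3) : ℝ :=
  ∫ t in (0:ℝ)..L, monopole v (x - b t) (deriv b t)

lemma exists_int_solidAngle_sub {b : ℝ → E3} (hb : ContDiff ℝ 1 b) {L : ℝ}
    (hper : Function.Periodic b L) {x v w : E3} (hv : IsStringDir b x v)
    (hw : IsStringDir b x w) :
    ∃ k : ℤ, solidAngle b L v x - solidAngle b L w x = 4 * π * k := by
  have hb' : Continuous (deriv b) := hb.continuous_deriv le_rfl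
  have hbc := hb.continuous
  have hd : ∀ t, HasDerivAt (fun t => x - b t) (-deriv b t) t := fun t =>
    (hb.differentiable one_ne_zero t).hasDerivAt.const_sub x
  have hns : ∀ t, spinorPairing v w (x - b t) ≠ 0 := fun t => by
    rw [← Complex.normSq_pos, normSq_spinorPairing _ hv.norm_eq hw.norm_eq]
    have := hv.one_add_dot3_pos hw
    have := hv.norm_add_pos t
    have := hw.norm_add_pos t
    positivity
  have hc : Continuous fun t => spinorPairingDeriv v w (x - b t) (-deriv b t) := by
    have := fun t => norm_ne_zero_iff.2 (hv.ne t)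
    simp only [spinorPairingDeriv, dot3, det3_eq]
    fun_prop (disch := assumption)
  obtain ⟨k, hk⟩ := exists_int_integral_logDeriv_im
    (fun t => (hd t).spinorPairing v w (hv.ne t)) hc hns (L := L)
    (by simpa using congrArg (fun z => spinorPairing v w (x - z)) (hper 0))
  refine ⟨k, ?_⟩
  have hint : ∀ u, IsStringDir b x u →
      IntervalIntegrable (fun t => monopole u (x - b t) (deriv b t)) volume 0 L := fun u hu =>
    (continuousOn_univ.1 (ContinuousOn.monopole u (by fun_prop) hb'.continuousOn
      fun t _ => hu.norm_add_pos t)).intervalIntegrable _ _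
  have e : ∀ t, (spinorPairingDeriv v w (x - b t) (-deriv b t) / spinorPairing v w (x - b t)).im
      = (1 / 2) * (monopole v (x - b t) (deriv b t) - monopole w (x - b t) (deriv b t)) := by
    intro t
    rw [im_spinorPairingDeriv_div _ hv.norm_eq hw.norm_eq (hv.ne t)
      (hv.one_add_dot3_pos hw).ne' (hv.norm_add_pos t).ne' (hw.norm_add_pos t).ne']
    simp only [monopole, det3_eq, PiLp.neg_apply]
    ring
  simp only [e, intervalIntegral.integral_const_mul] at hk
  rw [intervalIntegral.integral_sub (hint v hv) (hint w hw)] at hk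
  simp only [solidAngle]
  linarith

/-- The integrand of the Gauss linking integral. -/
def gaussKernel (a b : ℝ → E3) (s t : ℝ) : ℝ :=
  det3 (deriv a s) (deriv b t) (a s - b t) / ‖a s - b t‖ ^ 3

lemma continuous_gaussKernel {a b : ℝ → E3} (ha : ContDiff ℝ 1 a) (hb : ContDiff ℝ 1 b)
    (hab : ∀ s t, a s ≠ b t) : Continuous (Function.uncurry (gaussKernel a b)) := by
  have ha' : Continuous (deriv a) := ha.continuous_deriv le_rfl
  have hb' : Continuous (deriv b) := hb.continuous_deriv le_rfl
  have hac := ha.continuous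
  have hbc := hb.continuous
  have h0 : ∀ p : ℝ × ℝ, ‖a p.1 - b p.2‖ ^ 3 ≠ 0 := fun p =>
    pow_ne_zero _ (norm_ne_zero_iff.2 (sub_ne_zero.2 (hab _ _)))
  simp only [gaussKernel, Function.uncurry_def, det3_eq]
  fun_prop (disch := assumption)

lemma eventually_isStringDir {a b : ℝ → E3} (ha : Continuous a) (hb : Continuous b) {L : ℝ}
    (hL : 0 < L) (hbper : Function.Periodic b L) {s₀ : ℝ} {v : E3}
    (hv : IsStringDir b (a s₀) v) : ∀ᶠ s in 𝓝 s₀, IsStringDir b (a s) v := by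
  have hopen : IsOpen {p : ℝ × ℝ | 0 < ‖a p.1 - b p.2‖ + dot3 v (a p.1 - b p.2)} := by
    refine isOpen_lt continuous_const ?_
    simp only [dot3]
    fun_prop
  have := (isCompact_Icc (a := (0:ℝ)) (b := L)).eventually_forall_of_forall_eventually
    (x₀ := s₀) (P := fun s t => 0 < ‖a s - b t‖ + dot3 v (a s - b t))
    fun t _ => hopen.eventually_mem (show (s₀, t) ∈ _ from hv.norm_add_pos t)
  filter_upwards [this] with s hs
  refine ⟨hv.norm_eq, hv.pos, fun t => ?_⟩
  obtain ⟨t', ht', e⟩ := hbper.exists_mem_Ico₀ hL t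
  rw [e]
  exact hs t' (Ico_subset_Icc_self ht')

lemma hasDerivAt_solidAngle {a b : ℝ → E3} (ha : ContDiff ℝ 1 a) (hb : ContDiff ℝ 1 b) {L : ℝ}
    (hL : 0 < L) (hbper : Function.Periodic b L) (hab : ∀ s t, a s ≠ b t) {s₀ : ℝ} {v : E3}
    (hv : IsStringDir b (a s₀) v) :
    HasDerivAt (fun s => solidAngle b L v (a s)) (∫ t in (0:ℝ)..L, gaussKernel a b s₀ t) s₀ := by
  have ha' : Continuous (deriv a) := ha.continuous_deriv le_rfl
  have hb' : Continuous (deriv b) := hb.continuous_deriv le_rfl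
  have hac := ha.continuous
  have hbc := hb.continuous
  obtain ⟨U, hUv, hU, hsU⟩ := eventually_nhds_iff.1 (eventually_isStringDir hac hbc hL hbper hv)
  have hda : ∀ s t, HasDerivAt (fun s => a s - b t) (deriv a s) s := fun s t =>
    (ha.differentiable one_ne_zero s).hasDerivAt.sub_const _
  have hdb : ∀ t, HasDerivAt (fun t => a s₀ - b t) (-deriv b t) t := fun t =>
    (hb.differentiable one_ne_zero t).hasDerivAt.const_sub _
  have key := hasDerivAt_intervalIntegral_of_continuousOn hU 0 L
    (F := fun s t => monopole v (a s - b t) (deriv b t))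
    (F' := fun s t => monopoleDeriv v (a s - b t) (deriv a s) (deriv b t))
    (fun s hs => continuousOn_univ.1 (ContinuousOn.monopole v (by fun_prop) (by fun_prop)
      fun t _ => (hUv s hs).norm_add_pos t))
    (ContinuousOn.monopoleDeriv v (by fun_prop) (by fun_prop) (by fun_prop)
      fun p hp => (hUv p.1 hp.1).norm_add_pos p.2)
    (fun s hs t => (hda s t).monopole v _ ((hUv s hs).ne t) ((hUv s hs).norm_add_pos t).ne') hsU
  have hc : Continuous fun t => monopoleDeriv v (a s₀ - b t) (-deriv b t) (deriv a s₀) :=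
    continuousOn_univ.1 (ContinuousOn.monopoleDeriv v (by fun_prop) (by fun_prop) (by fun_prop)
      fun t _ => hv.norm_add_pos t)
  have hzero : ∫ t in (0:ℝ)..L, monopoleDeriv v (a s₀ - b t) (-deriv b t) (deriv a s₀) = 0 := by
    rw [intervalIntegral.integral_eq_sub_of_hasDerivAt (fun t _ =>
      (hdb t).monopole v (deriv a s₀) (hv.ne t) (hv.norm_add_pos t).ne')
      (hc.intervalIntegrable _ _)]
    have := hbper 0
    rw [zero_add] at this
    rw [this, sub_self]
  have hG : Continuous (gaussKernel a b s₀) :=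
    (continuous_gaussKernel ha hb hab).comp (f := fun t => (s₀, t)) (by fun_prop)
  have e : ∀ t, monopoleDeriv v (a s₀ - b t) (deriv a s₀) (deriv b t) =
      gaussKernel a b s₀ t - monopoleDeriv v (a s₀ - b t) (-deriv b t) (deriv a s₀) := by
    intro t
    have h1 := monopoleDeriv_sub_swap (deriv a s₀) (deriv b t) hv.norm_eq (hv.ne t)
      (hv.norm_add_pos t).ne'
    have h2 : monopoleDeriv v (a s₀ - b t) (-deriv b t) (deriv a s₀) =
        -monopoleDeriv v (a s₀ - b t) (deriv b t) (deriv a s₀) := by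
      simp only [monopoleDeriv, det3_eq, dot3, PiLp.neg_apply]
      ring
    have h3 : gaussKernel a b s₀ t =
        det3 (a s₀ - b t) (deriv a s₀) (deriv b t) / ‖a s₀ - b t‖ ^ 3 := by
      simp only [gaussKernel, det3_eq]
      ring
    rw [h2, h3]
    linarith
  simp only [e] at key
  rwa [intervalIntegral.integral_sub (hG.intervalIntegrable _ _) (hc.intervalIntegrable _ _),
    hzero, sub_zero] at key

/-- The Gauss linking integral of two disjoint closed curves is an integer. -/
theorem exists_int_linkInt {a b : ℝ → E3} (ha : ContDiff ℝ 1 a) (hb : ContDiff ℝ 1 b) {L : ℝ}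
    (hL : 0 < L) (haper : Function.Periodic a L) (hbper : Function.Periodic b L)
    (hab : ∀ s t, a s ≠ b t) : ∃ k : ℤ, linkInt a b L = k := by
  choose v hv using fun s => exists_isStringDir hb (hab s)
  have hK : Continuous fun s => ∫ t in (0:ℝ)..L, gaussKernel a b s t :=
    intervalIntegral.continuous_parametric_intervalIntegral_of_continuous'
      (continuous_gaussKernel ha hb hab) 0 L
  have hphase : ∀ s u w, IsStringDir b (a s) u → IsStringDir b (a s) w →
      Complex.exp (solidAngle b L u (a s) / 2 * Complex.I) =
        Complex.exp (solidAngle b L w (a s) / 2 * Complex.I) := by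
    intro s u w hu hw
    obtain ⟨k, hk⟩ := exists_int_solidAngle_sub hb hbper hu hw
    rw [Complex.exp_eq_exp_iff_exists_int]
    refine ⟨k, ?_⟩
    rw [sub_eq_iff_eq_add.1 hk]
    push_cast
    ring
  have hI : ∀ x, HasDerivAt (fun x => ∫ s in (0:ℝ)..x, ∫ t in (0:ℝ)..L, gaussKernel a b s t)
      (∫ t in (0:ℝ)..L, gaussKernel a b x t) x := fun x =>
    intervalIntegral.integral_hasDerivAt_right (hK.intervalIntegrable _ _)
      (hK.stronglyMeasurableAtFilter _ _) hK.continuousAt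
  have hy : ∀ x, HasDerivAt (fun s => Complex.exp (solidAngle b L (v s) (a s) / 2 * Complex.I) *
      Complex.exp (-((∫ s in (0:ℝ)..s, ∫ t in (0:ℝ)..L, gaussKernel a b s t : ℝ) / 2
        * Complex.I))) 0 x := by
    intro x
    have h1 := (((hasDerivAt_solidAngle ha hb hL hbper hab (hv x)).ofReal_comp.div_const
      2).mul_const Complex.I).cexp.mul ((((hI x).ofReal_comp.div_const 2).mul_const
        Complex.I).neg.cexp)
    refine (h1.congr_of_eventuallyEq ?_).congr_deriv (by ring)
    filter_upwards [eventually_isStringDir ha.continuous hb.continuous hL hbper (hv x)] with s hs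
    rw [hphase s _ _ (hv s) hs]
    rfl
  have hconst := is_const_of_deriv_eq_zero (fun x => (hy x).differentiableAt)
    (fun x => (hy x).deriv) L 0
  have haL : a L = a 0 := by simpa using haper 0
  have hv0 : IsStringDir b (a 0) (v L) := haL ▸ hv L
  simp only [intervalIntegral.integral_same, Complex.ofReal_zero, zero_div, zero_mul, neg_zero,
    Complex.exp_zero] at hconst
  rw [haL, hphase 0 _ _ hv0 (hv 0)] at hconst
  obtain ⟨n, hn⟩ := Complex.exp_eq_one_iff.1 (mul_left_cancel₀ (Complex.exp_ne_zero _) hconst)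
  refine ⟨-n, ?_⟩
  have him := congrArg Complex.im hn
  simp only [← Complex.ofReal_ofNat, ← Complex.ofReal_div, ← Complex.ofReal_mul,
    ← Complex.ofReal_intCast, ← mul_assoc] at him
  simp at him
  change 1 / (4 * π) * (∫ s in (0:ℝ)..L, ∫ t in (0:ℝ)..L, gaussKernel a b s t) = _
  have : (∫ s in (0:ℝ)..L, ∫ t in (0:ℝ)..L, gaussKernel a b s t) = 4 * π * (-n) := by linarith
  rw [this]
  field_simp
  push_cast
  ring

end LinkingInteger

section Taylor

lemma Function.Periodic.deriv_e3 {φ : ℝ → E3} {L : ℝ} (h : Function.Periodic φ L) :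
    Function.Periodic (deriv φ) L := fun x => by
  rw [← deriv_comp_add_const, h.funext]

lemma Function.Periodic.exists_norm_le {φ : ℝ → E3} {L : ℝ} (h : Function.Periodic φ L)
    (hL : L ≠ 0) (hφ : Continuous φ) : ∃ C, ∀ s, ‖φ s‖ ≤ C := by
  obtain ⟨C, hC⟩ := (h.compact_of_continuous hL hφ).isBounded.exists_norm_le
  exact ⟨C, fun s => hC _ ⟨s, rfl⟩⟩

lemma norm_add_sub_le {φ : ℝ → E3} (hφ : Differentiable ℝ φ) {C : ℝ}
    (hC : ∀ s, ‖deriv φ s‖ ≤ C) (s h : ℝ) : ‖φ (s + h) - φ s‖ ≤ C * |h| := by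
  simpa using convex_univ.norm_image_sub_le_of_norm_deriv_le (fun x _ => hφ x) (fun x _ => hC x)
    (mem_univ s) (mem_univ (s + h))

lemma norm_add_sub_sub_smul_le {φ : ℝ → E3} (hφ : Differentiable ℝ φ)
    (hφ' : Differentiable ℝ (deriv φ)) {C : ℝ} (hC : ∀ s, ‖deriv (deriv φ) s‖ ≤ C) (s h : ℝ) :
    ‖φ (s + h) - φ s - h • deriv φ s‖ ≤ C * h ^ 2 := by
  have hd : ∀ x, HasDerivAt (fun x => φ (s + x) - x • deriv φ s) (deriv φ (s + x) - deriv φ s) x :=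
    fun x => by
      have h1 := (hφ (s + x)).hasDerivAt.comp_const_add s x
      exact (h1.sub ((hasDerivAt_id x).smul_const (deriv φ s))).congr_deriv (by rw [one_smul])
  have hb : ∀ x ∈ uIcc 0 h, ‖deriv φ (s + x) - deriv φ s‖ ≤ C * |h| := fun x hx => by
    refine (norm_add_sub_le hφ' hC s x).trans ?_
    have : |x| ≤ |h| := by simpa using abs_sub_left_of_mem_uIcc hx
    exact mul_le_mul_of_nonneg_left this ((norm_nonneg _).trans (hC s))
  have := (convex_uIcc 0 h).norm_image_sub_le_of_norm_hasDerivWithin_le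
    (fun x _ => (hd x).hasDerivWithinAt) hb left_mem_uIcc right_mem_uIcc
  simp only [add_zero, zero_smul, sub_zero, Real.norm_eq_abs] at this
  rw [mul_assoc, abs_mul_abs_self, ← sq] at this
  rwa [sub_right_comm]

/-- Uniform first-order Taylor bounds for a framed curve. -/
structure RibbonBounds (f u : ℝ → E3) (K : ℝ) : Prop where
  one_le : 1 ≤ K
  norm_deriv2_le : ∀ s, ‖deriv (deriv f) s‖ ≤ K
  norm_deriv_framing_le : ∀ s, ‖deriv u s‖ ≤ K
  taylor : ∀ s h, ‖f (s + h) - f s - h • deriv f s‖ ≤ K * h ^ 2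
  taylor_deriv : ∀ s h, ‖deriv f (s + h) - deriv f s - h • deriv (deriv f) s‖ ≤ K * h ^ 2
  framing : ∀ s h, ‖u (s + h) - u s‖ ≤ K * |h|
  framing_deriv : ∀ s h, ‖deriv u (s + h) - deriv u s‖ ≤ K * |h|

lemma exists_ribbonBounds {f u : ℝ → E3} {L : ℝ} (hL : L ≠ 0) (hf : ContDiff ℝ (⊤ : ℕ∞) f)
    (hper : Function.Periodic f L) (hu : ContDiff ℝ (⊤ : ℕ∞) u) (huper : Function.Periodic u L) :
    ∃ K, RibbonBounds f u K := by
  obtain ⟨df, hf1⟩ := contDiff_infty_iff_deriv.1 hf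
  obtain ⟨df1, hf2⟩ := contDiff_infty_iff_deriv.1 hf1
  obtain ⟨df2, hf3⟩ := contDiff_infty_iff_deriv.1 hf2
  obtain ⟨du, hu1⟩ := contDiff_infty_iff_deriv.1 hu
  obtain ⟨du1, hu2⟩ := contDiff_infty_iff_deriv.1 hu1
  obtain ⟨C1, h1⟩ := hper.deriv_e3.deriv_e3.exists_norm_le hL hf2.continuous
  obtain ⟨C2, h2⟩ := hper.deriv_e3.deriv_e3.deriv_e3.exists_norm_le hL hf3.continuous
  obtain ⟨C3, h3⟩ := huper.deriv_e3.exists_norm_le hL hu1.continuous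
  obtain ⟨C4, h4⟩ := huper.deriv_e3.deriv_e3.exists_norm_le hL hu2.continuous
  obtain ⟨K, hK⟩ : ∃ K, K = max 1 (max (max C1 C2) (max C3 C4)) := ⟨_, rfl⟩
  have k0 : 1 ≤ K := by rw [hK]; exact le_max_left _ _
  have k1 : C1 ≤ K := by simp [hK]
  have k2 : C2 ≤ K := by simp [hK]
  have k3 : C3 ≤ K := by simp [hK]
  have k4 : C4 ≤ K := by simp [hK]
  exact ⟨K, k0, fun s => (h1 s).trans k1, fun s => (h3 s).trans k3,
    norm_add_sub_sub_smul_le df df1 fun s => (h1 s).trans k1,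
    norm_add_sub_sub_smul_le df1 df2 fun s => (h2 s).trans k2,
    norm_add_sub_le du fun s => (h3 s).trans k3,
    norm_add_sub_le du1 fun s => (h4 s).trans k4⟩

end Taylor

section LocalModel

/-- The numerator of the local model of the Gauss integrand near the diagonal. -/
def modelNumerator (a a' v v' : E3) (ε h : ℝ) : ℝ :=
  -(ε * h * det3 a a' v) - ε ^ 2 * det3 a v' v

lemma norm_neg_smul_sub_smul {a v : E3} (ha : ‖a‖ = 1) (hv : ‖v‖ = 1) (hav : dot3 v a = 0)
    (ε h : ℝ) : ‖-(h • a) - ε • v‖ = √(h ^ 2 + ε ^ 2) := by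
  rw [← Real.sqrt_sq (norm_nonneg _)]
  congr 1
  have ha2 : a 0 ^ 2 + a 1 ^ 2 + a 2 ^ 2 = 1 := by rw [← norm_sq_eq, ha]; norm_num
  have hv2 : v 0 ^ 2 + v 1 ^ 2 + v 2 ^ 2 = 1 := by rw [← norm_sq_eq, hv]; norm_num
  rw [dot3] at hav
  rw [norm_sq_eq]
  simp only [PiLp.sub_apply, PiLp.neg_apply, PiLp.smul_apply, smul_eq_mul]
  linear_combination h ^ 2 * ha2 + ε ^ 2 * hv2 + 2 * h * ε * hav

lemma abs_div_cube_sub_div_cube_le {N S n ρ E F C D κ : ℝ} (hκ : 0 < κ) (hρ : 0 < ρ)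
    (hC : 0 ≤ C) (hNS : |N - S| ≤ E * ρ ^ 3) (hS : |S| ≤ F * ρ ^ 2) (hnρ : |n - ρ| ≤ C * ρ ^ 2)
    (hn : n ≤ D * ρ) (hκn : κ * ρ ≤ n) :
    |N / n ^ 3 - S / ρ ^ 3| ≤ (E + F * C * (1 + D + D ^ 2)) / κ ^ 3 := by
  have hn0 : 0 < n := (mul_pos hκ hρ).trans_le hκn
  have hF : 0 ≤ F * ρ ^ 2 := (abs_nonneg _).trans hS
  have e : N / n ^ 3 - S / ρ ^ 3 =
      ((N - S) - S / ρ ^ 3 * ((n - ρ) * (ρ ^ 2 + n * ρ + n ^ 2))) / n ^ 3 := by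
    field_simp
    ring
  have hnsq : n ^ 2 ≤ D ^ 2 * ρ ^ 2 := by
    rw [← mul_pow]; exact pow_le_pow_left₀ hn0.le hn 2
  have h1 : |S / ρ ^ 3 * ((n - ρ) * (ρ ^ 2 + n * ρ + n ^ 2))| ≤
      F * C * (1 + D + D ^ 2) * ρ ^ 3 := by
    have hpos : 0 ≤ ρ ^ 2 + n * ρ + n ^ 2 := by positivity
    have hle : ρ ^ 2 + n * ρ + n ^ 2 ≤ (1 + D + D ^ 2) * ρ ^ 2 := by nlinarith
    rw [abs_mul, abs_mul, abs_div, abs_of_pos (pow_pos hρ 3), abs_of_nonneg hpos]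
    calc |S| / ρ ^ 3 * (|n - ρ| * (ρ ^ 2 + n * ρ + n ^ 2))
        ≤ F * ρ ^ 2 / ρ ^ 3 * (C * ρ ^ 2 * ((1 + D + D ^ 2) * ρ ^ 2)) := by gcongr
      _ = F * C * (1 + D + D ^ 2) * ρ ^ 3 := by field_simp
  rw [e, abs_div, abs_of_pos (pow_pos hn0 3)]
  have hnum : |(N - S) - S / ρ ^ 3 * ((n - ρ) * (ρ ^ 2 + n * ρ + n ^ 2))| ≤
      (E + F * C * (1 + D + D ^ 2)) * ρ ^ 3 := (abs_sub _ _).trans (by linarith)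
  have hnn : 0 ≤ (E + F * C * (1 + D + D ^ 2)) * ρ ^ 3 := (abs_nonneg _).trans hnum
  calc _ ≤ (E + F * C * (1 + D + D ^ 2)) * ρ ^ 3 / (κ * ρ) ^ 3 := by gcongr
    _ = _ := by field_simp

lemma abs_gauss_sub_model_le {a a' v v' b w : E3} {ε h ρ C κ R : ℝ} (ha : ‖a‖ = 1) (hv : ‖v‖ = 1)
    (hav : dot3 v a = 0) (hρ : ρ = √(h ^ 2 + ε ^ 2)) (hρ0 : 0 < ρ) (hκ : 0 < κ) (hC : 0 ≤ C)
    (hR : ρ ≤ R) (ha' : ‖a'‖ ≤ C) (hv' : ‖v'‖ ≤ C)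
    (hb : ‖b - a - (h • a' + ε • v')‖ ≤ C * ρ ^ 2)
    (hw : ‖w - (-(h • a) - ε • v)‖ ≤ C * ρ ^ 2) (hκw : κ * ρ ≤ ‖w‖) :
    |det3 a b w / ‖w‖ ^ 3 - modelNumerator a a' v v' ε h / ρ ^ 3| ≤
      (6 * (C * (1 + C * R)) + 12 * C ^ 2
        + 12 * C * C * (1 + (1 + C * R) + (1 + C * R) ^ 2)) / κ ^ 3 := by
  have hM := norm_neg_smul_sub_smul ha hv hav ε h
  rw [← hρ] at hM
  have hhρ : |h| ≤ ρ := hρ ▸ Real.abs_le_sqrt (by nlinarith)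
  have hερ : |ε| ≤ ρ := hρ ▸ Real.abs_le_sqrt (by nlinarith)
  have hnρ : |‖w‖ - ρ| ≤ C * ρ ^ 2 := by
    have := (abs_norm_sub_norm_le w (-(h • a) - ε • v)).trans hw
    rwa [hM] at this
  have hCρ : C * ρ ^ 2 ≤ C * R * ρ := by nlinarith [mul_nonneg hC hρ0.le]
  have hB : ‖h • a' + ε • v'‖ ≤ 2 * C * ρ := by
    refine (norm_add_le _ _).trans ?_
    rw [norm_smul, norm_smul, Real.norm_eq_abs, Real.norm_eq_abs]
    nlinarith [mul_le_mul hhρ ha' (norm_nonneg _) hρ0.le,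
      mul_le_mul hερ hv' (norm_nonneg _) hρ0.le]
  have hεv : ‖-(ε • v)‖ ≤ ρ := by rwa [norm_neg, norm_smul, hv, mul_one, Real.norm_eq_abs]
  have hS : modelNumerator a a' v v' ε h = det3 a (h • a' + ε • v') (-(ε • v)) := by
    simp only [modelNumerator, det3_eq, PiLp.add_apply, PiLp.neg_apply, PiLp.smul_apply,
      smul_eq_mul]
    ring
  refine abs_div_cube_sub_div_cube_le hκ hρ0 hC ?_ ?_ hnρ
    (by linarith [(abs_le.1 hnρ).2]) hκw
  · have e : det3 a b w - modelNumerator a a' v v' ε h =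
        det3 a (b - a - (h • a' + ε • v')) (-(ε • v) + (w - (-(h • a) - ε • v)))
          + det3 a (h • a' + ε • v') (w - (-(h • a) - ε • v)) := by
      rw [hS]
      simp only [det3_eq, PiLp.add_apply, PiLp.sub_apply, PiLp.neg_apply, PiLp.smul_apply,
        smul_eq_mul]
      ring
    rw [e]
    refine (abs_add_le _ _).trans ?_
    have h1 := abs_det3_le a (b - a - (h • a' + ε • v')) (-(ε • v) + (w - (-(h • a) - ε • v)))
    have h2 := abs_det3_le a (h • a' + ε • v') (w - (-(h • a) - ε • v))
    have h3 : ‖-(ε • v) + (w - (-(h • a) - ε • v))‖ ≤ (1 + C * R) * ρ :=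
      (norm_add_le _ _).trans (by linarith)
    rw [ha, one_mul] at h1 h2
    have h4 := mul_le_mul hb h3 (norm_nonneg _) (by positivity)
    have h5 := mul_le_mul hB hw (norm_nonneg _) (by positivity)
    linarith
  · rw [hS]
    refine (abs_det3_le _ _ _).trans ?_
    rw [ha, one_mul]
    have := mul_le_mul hB hεv (norm_nonneg _) (by positivity)
    linarith

lemma hasDerivAt_inv_sqrt_primitives {ε : ℝ} (hε : 0 < ε) (c τ h : ℝ) :
    HasDerivAt (fun x => (-(ε * c) + τ * x) / √(x ^ 2 + ε ^ 2))
      ((ε * h * c + ε ^ 2 * τ) / √(h ^ 2 + ε ^ 2) ^ 3) h := by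
  have hpos : 0 < h ^ 2 + ε ^ 2 := by positivity
  have h1 : HasDerivAt (fun x : ℝ => x ^ 2 + ε ^ 2) (2 * h) h := by
    simpa using (hasDerivAt_pow 2 h).add_const (ε ^ 2)
  have h2 : HasDerivAt (fun x => -(ε * c) + τ * x) τ h := by
    simpa using ((hasDerivAt_id h).const_mul τ).const_add (-(ε * c))
  refine (h2.div (h1.sqrt hpos.ne') (Real.sqrt_pos.2 hpos).ne').congr_deriv ?_
  have hs := Real.sq_sqrt hpos.le
  have hs0 := Real.sqrt_pos.2 hpos
  generalize √(h ^ 2 + ε ^ 2) = ρ at *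
  field_simp
  rw [hs]
  ring

lemma integral_model (a a' v v' : E3) {ε : ℝ} (hε : 0 < ε) (L : ℝ) :
    ∫ h in (-(L / 2))..(L / 2), modelNumerator a a' v v' ε h / √(h ^ 2 + ε ^ 2) ^ 3 =
      L / √((L / 2) ^ 2 + ε ^ 2) * (-det3 a v' v) := by
  have h0 : ∀ h : ℝ, √(h ^ 2 + ε ^ 2) ^ 3 ≠ 0 := fun h => by positivity
  have hc : Continuous fun h => modelNumerator a a' v v' ε h / √(h ^ 2 + ε ^ 2) ^ 3 := by
    simp only [modelNumerator]
    fun_prop (disch := assumption)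
  rw [intervalIntegral.integral_eq_sub_of_hasDerivAt (fun h _ =>
    (hasDerivAt_inv_sqrt_primitives hε (-det3 a a' v) (-det3 a v' v) h).congr_deriv
      (by simp only [modelNumerator]; ring)) (hc.intervalIntegrable _ _)]
  rw [neg_sq]
  ring

end LocalModel

section PushOff

variable {f u : ℝ → E3} {L : ℝ}

lemma exists_int_of_apply_eq (hL : 0 < L) (hper : Function.Periodic f L)
    (hinj : InjOn f (Ico 0 L)) {x y : ℝ} (h : f x = f y) : ∃ k : ℤ, y - x = k * L := by
  have hm := fun z => toIcoMod_mem_Ico' hL z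
  have he : ∀ z, f (toIcoMod hL 0 z) = f z := fun z => by
    rw [toIcoMod]; exact hper.sub_zsmul_eq _
  have := hinj (hm x) (hm y) (by simpa [he] using h)
  refine ⟨toIcoDiv hL 0 y - toIcoDiv hL 0 x, ?_⟩
  simp only [toIcoMod, zsmul_eq_mul] at this
  push_cast
  linarith

lemma apply_ne_apply_add (hL : 0 < L) (hper : Function.Periodic f L)
    (hinj : InjOn f (Ico 0 L)) (s : ℝ) {h : ℝ} (h0 : h ≠ 0) (hh : |h| ≤ L / 2) :
    f s ≠ f (s + h) := by
  intro e
  obtain ⟨k, hk⟩ := exists_int_of_apply_eq hL hper hinj e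
  rw [add_sub_cancel_left] at hk
  have hk0 : k ≠ 0 := by rintro rfl; simp at hk; exact h0 hk
  have : (1 : ℝ) ≤ |(k : ℝ)| := by exact_mod_cast Int.one_le_abs hk0
  rw [hk, abs_mul, abs_of_pos hL] at hh
  nlinarith

lemma exists_pos_le_norm_sub (hL : 0 < L) (hf : Continuous f) (hper : Function.Periodic f L)
    (hinj : InjOn f (Ico 0 L)) {δ : ℝ} (hδ : 0 < δ) :
    ∃ m > 0, ∀ s h : ℝ, δ ≤ |h| → |h| ≤ L / 2 → m ≤ ‖f s - f (s + h)‖ := by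
  have hK : IsCompact (Icc (0:ℝ) L ×ˢ {h : ℝ | δ ≤ |h| ∧ |h| ≤ L / 2}) := by
    refine isCompact_Icc.prod ((isCompact_Icc (a := -(L / 2)) (b := L / 2)).of_isClosed_subset
      ?_ fun h hh => abs_le.1 hh.2)
    exact (isClosed_le continuous_const continuous_abs).inter
      (isClosed_le continuous_abs continuous_const)
  obtain ⟨m, hm, hmK⟩ := hK.exists_forall_le' (f := fun p : ℝ × ℝ => ‖f p.1 - f (p.1 + p.2)‖)
    (by fun_prop) (a := 0) fun p hp => norm_pos_iff.2 (sub_ne_zero.2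
      (apply_ne_apply_add hL hper hinj p.1 (abs_pos.1 (hδ.trans_le hp.2.1)) hp.2.2))
  refine ⟨m, hm, fun s h h1 h2 => ?_⟩
  have hp : Function.Periodic (fun s => ‖f s - f (s + h)‖) L := fun s => by
    simp only [add_right_comm s L h, hper s, hper (s + h)]
  obtain ⟨s', hs', e⟩ := hp.exists_mem_Ico₀ hL s
  exact e ▸ hmK (s', h) ⟨Ico_subset_Icc_self hs', h1, h2⟩

lemma RibbonBounds.norm_sub_model_le {K : ℝ} (hK : RibbonBounds f u K) (s h : ℝ) {ε : ℝ}
    (hε : 0 < ε) :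
    ‖f s - (f (s + h) + ε • u (s + h)) - (-(h • deriv f s) - ε • u s)‖ ≤
      2 * K * √(h ^ 2 + ε ^ 2) ^ 2 := by
  have e : f s - (f (s + h) + ε • u (s + h)) - (-(h • deriv f s) - ε • u s) =
      -(f (s + h) - f s - h • deriv f s) - ε • (u (s + h) - u s) := by module
  rw [e, Real.sq_sqrt (by positivity)]
  refine (norm_sub_le _ _).trans ?_
  rw [norm_neg, norm_smul, Real.norm_of_nonneg hε.le]
  have h1 := hK.taylor s h
  have h2 := mul_le_mul_of_nonneg_left (hK.framing s h) hε.le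
  nlinarith [hK.one_le, sq_nonneg (|h| - ε), sq_abs h,
    mul_nonneg (zero_le_one.trans hK.one_le) (sq_nonneg (|h| - ε)),
    mul_nonneg (zero_le_one.trans hK.one_le) (sq_nonneg ε)]

lemma RibbonBounds.norm_deriv_sub_model_le {K : ℝ} (hK : RibbonBounds f u K) (s h : ℝ) {ε : ℝ}
    (hε : 0 < ε) :
    ‖deriv f (s + h) + ε • deriv u (s + h) - deriv f s
        - (h • deriv (deriv f) s + ε • deriv u s)‖ ≤ 2 * K * √(h ^ 2 + ε ^ 2) ^ 2 := by
  have e : deriv f (s + h) + ε • deriv u (s + h) - deriv f s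
        - (h • deriv (deriv f) s + ε • deriv u s) =
      (deriv f (s + h) - deriv f s - h • deriv (deriv f) s)
        + ε • (deriv u (s + h) - deriv u s) := by module
  rw [e, Real.sq_sqrt (by positivity)]
  refine (norm_add_le _ _).trans ?_
  rw [norm_smul, Real.norm_of_nonneg hε.le]
  have h1 := hK.taylor_deriv s h
  have h2 := mul_le_mul_of_nonneg_left (hK.framing_deriv s h) hε.le
  nlinarith [hK.one_le, sq_nonneg (|h| - ε), sq_abs h,
    mul_nonneg (zero_le_one.trans hK.one_le) (sq_nonneg (|h| - ε)),
    mul_nonneg (zero_le_one.trans hK.one_le) (sq_nonneg ε)]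

/-- The distance between a curve and its push-off is comparable to the distance in the straight
model. -/
lemma exists_pushOff_lower_bound (hL : 0 < L) (hf : Continuous f) (hper : Function.Periodic f L)
    (harc : ∀ s, ‖deriv f s‖ = 1) (hinj : InjOn f (Ico 0 L)) (hunit : ∀ s, ‖u s‖ = 1)
    (hnormal : ∀ s, dot3 (u s) (deriv f s) = 0) {K : ℝ} (hK : RibbonBounds f u K) :
    ∃ ε₀ > 0, ε₀ ≤ 1 ∧ ∃ κ > 0, ∀ ε, 0 < ε → ε < ε₀ → ∀ s h : ℝ, |h| ≤ L / 2 →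
      κ * √(h ^ 2 + ε ^ 2) ≤ ‖f s - (f (s + h) + ε • u (s + h))‖ := by
  have hK0 : 0 < K := zero_lt_one.trans_le hK.one_le
  obtain ⟨δ, hδ⟩ : ∃ δ, δ = 1 / (8 * K) := ⟨_, rfl⟩
  have hδ0 : 0 < δ := by rw [hδ]; positivity
  obtain ⟨m, hm, hmf⟩ := exists_pos_le_norm_sub hL hf hper hinj hδ0
  refine ⟨min 1 (min δ (m / 2)), by positivity, min_le_left _ _,
    min (1 / 2) (m / 2 / (L / 2 + 1)), by positivity, fun ε hε hε₀ s h hh => ?_⟩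
  have hε1 : ε ≤ 1 := hε₀.le.trans (min_le_left _ _)
  have hεδ : ε ≤ δ := hε₀.le.trans ((min_le_right _ _).trans (min_le_left _ _))
  have hεm : ε ≤ m / 2 := hε₀.le.trans ((min_le_right _ _).trans (min_le_right _ _))
  have hρ0 : 0 < √(h ^ 2 + ε ^ 2) := Real.sqrt_pos.2 (by positivity)
  have hρle : √(h ^ 2 + ε ^ 2) ≤ |h| + ε :=
    Real.sqrt_le_iff.2 ⟨by positivity, by nlinarith [sq_abs h, abs_nonneg h]⟩
  rcases le_or_gt δ |h| with hδh | hδh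
  · have h1 := hmf s h hδh hh
    have h2 : ‖f s - f (s + h)‖ ≤ ‖f s - (f (s + h) + ε • u (s + h))‖ + ε := by
      have e : f s - f (s + h) = f s - (f (s + h) + ε • u (s + h)) + ε • u (s + h) := by abel
      have h3 := norm_add_le (f s - (f (s + h) + ε • u (s + h))) (ε • u (s + h))
      rwa [← e, norm_smul, hunit, mul_one, Real.norm_of_nonneg hε.le] at h3
    calc min (1 / 2) (m / 2 / (L / 2 + 1)) * √(h ^ 2 + ε ^ 2)
        ≤ m / 2 / (L / 2 + 1) * (L / 2 + 1) := by
          gcongr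
          · exact min_le_right _ _
          · linarith
      _ = m / 2 := by field_simp
      _ ≤ _ := by linarith
  · have h1 := hK.norm_sub_model_le s h hε
    have h2 := norm_neg_smul_sub_smul (harc s) (hunit s) (hnormal s) ε h
    have h3 := (abs_norm_sub_norm_le _ _).trans h1
    rw [h2] at h3
    have h4 : 2 * K * √(h ^ 2 + ε ^ 2) ≤ 1 / 2 := by
      have : 2 * K * (2 * δ) = 1 / 2 := by rw [hδ]; field_simp; norm_num
      rw [← this]
      gcongr
      linarith
    have h5 : min (1 / 2) (m / 2 / (L / 2 + 1)) * √(h ^ 2 + ε ^ 2) ≤ 1 / 2 * √(h ^ 2 + ε ^ 2) := by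
      gcongr
      exact min_le_left _ _
    nlinarith [(abs_le.1 h3).1]

lemma pushOff_disjoint (hL : 0 < L) (hper : Function.Periodic f L) (huper : Function.Periodic u L)
    {ε κ : ℝ} (hε : 0 < ε) (hκ : 0 < κ)
    (h : ∀ s h : ℝ, |h| ≤ L / 2 → κ * √(h ^ 2 + ε ^ 2) ≤ ‖f s - (f (s + h) + ε • u (s + h))‖)
    (s t : ℝ) : f s ≠ f t + ε • u t := by
  intro e
  have hr := abs_sub_round ((t - s) / L)
  have hh : |t - s - round ((t - s) / L) * L| ≤ L / 2 := by
    have : t - s - round ((t - s) / L) * L = ((t - s) / L - round ((t - s) / L)) * L := by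
      field_simp
    rw [this, abs_mul, abs_of_pos hL]
    nlinarith
  have hb := h s _ hh
  have hst : s + (t - s - round ((t - s) / L) * L) = t - round ((t - s) / L) * L := by ring
  rw [hst, hper.sub_int_mul_eq, huper.sub_int_mul_eq, e, sub_self, norm_zero] at hb
  have : 0 < κ * √((t - s - round ((t - s) / L) * L) ^ 2 + ε ^ 2) := by positivity
  linarith

/-- The Gauss integrand of a curve and its push-off, minus its local model. -/
def gaussRemainder (f u : ℝ → E3) (ε s h : ℝ) : ℝ :=
  gaussKernel f (fun t => f t + ε • u t) s (s + h) -
    modelNumerator (deriv f s) (deriv (deriv f) s) (u s) (deriv u s) ε h /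
      √(h ^ 2 + ε ^ 2) ^ 3

lemma deriv_add_smul (hf : Differentiable ℝ f) (hu : Differentiable ℝ u) (ε t : ℝ) :
    deriv (fun t => f t + ε • u t) t = deriv f t + ε • deriv u t :=
  ((hf t).hasDerivAt.add ((hu t).hasDerivAt.const_smul ε)).deriv

lemma RibbonBounds.exists_abs_gaussRemainder_le {K : ℝ} (hK : RibbonBounds f u K)
    (hf : Differentiable ℝ f) (hu : Differentiable ℝ u) (harc : ∀ s, ‖deriv f s‖ = 1)
    (hunit : ∀ s, ‖u s‖ = 1) (hnormal : ∀ s, dot3 (u s) (deriv f s) = 0) {κ : ℝ} (hκ : 0 < κ) :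
    ∃ B, ∀ ε, 0 < ε → ε ≤ 1 →
      (∀ s h : ℝ, |h| ≤ L / 2 → κ * √(h ^ 2 + ε ^ 2) ≤ ‖f s - (f (s + h) + ε • u (s + h))‖) →
      ∀ s h : ℝ, |h| ≤ L / 2 → |gaussRemainder f u ε s h| ≤ B := by
  have hK0 : 0 < K := zero_lt_one.trans_le hK.one_le
  refine ⟨(6 * (2 * K * (1 + 2 * K * (L / 2 + 1))) + 12 * (2 * K) ^ 2 + 12 * (2 * K) * (2 * K) *
    (1 + (1 + 2 * K * (L / 2 + 1)) + (1 + 2 * K * (L / 2 + 1)) ^ 2)) / κ ^ 3,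
    fun ε hε hε1 hκw s h hh => ?_⟩
  have hρ0 : 0 < √(h ^ 2 + ε ^ 2) := Real.sqrt_pos.2 (by positivity)
  have hρle : √(h ^ 2 + ε ^ 2) ≤ L / 2 + 1 := Real.sqrt_le_iff.2
    ⟨by linarith [abs_nonneg h], by nlinarith [sq_abs h, abs_nonneg h]⟩
  simp only [gaussRemainder, gaussKernel, deriv_add_smul hf hu]
  exact abs_gauss_sub_model_le (C := 2 * K) (R := L / 2 + 1) (harc s) (hunit s) (hnormal s) rfl
    hρ0 hκ (by positivity) hρle (by linarith [hK.norm_deriv2_le s])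
    (by linarith [hK.norm_deriv_framing_le s]) (hK.norm_deriv_sub_model_le s h hε)
    (hK.norm_sub_model_le s h hε) (hκw s h hh)

lemma tendsto_gaussRemainder (hf : Differentiable ℝ f) (hu : Differentiable ℝ u) {s h : ℝ}
    (h0 : h ≠ 0) (hne : f s ≠ f (s + h)) :
    Tendsto (fun ε : ℝ => gaussRemainder f u ε s h) (𝓝[>] 0) (𝓝 (gaussKernel f f s (s + h))) := by
  have hden : ∀ ε : ℝ, √(h ^ 2 + ε ^ 2) ^ 3 ≠ 0 := fun ε => by positivity
  have hc : ContinuousAt (fun ε => gaussRemainder f u ε s h) 0 := by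
    simp only [gaussRemainder, gaussKernel, deriv_add_smul hf hu]
    refine ContinuousAt.sub (ContinuousAt.div ?_ ?_ ?_) ?_
    · simp only [det3_eq]; fun_prop
    · fun_prop
    · simpa using sub_ne_zero.2 hne
    · simp only [modelNumerator]; fun_prop (disch := exact hden _)
  have e : gaussRemainder f u 0 s h = gaussKernel f f s (s + h) := by
    simp [gaussRemainder, modelNumerator]
  exact e ▸ hc.tendsto.mono_left nhdsWithin_le_nhds

lemma gaussKernel_periodic_right {a b : ℝ → E3} (hb : Function.Periodic b L) (s : ℝ) :
    Function.Periodic (gaussKernel a b s) L := fun t => by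
  simp only [gaussKernel, hb t, hb.deriv_e3 t]

lemma integral_gaussKernel_shift {a b : ℝ → E3} (hb : Function.Periodic b L) (s : ℝ) :
    ∫ t in (0:ℝ)..L, gaussKernel a b s t =
      ∫ h in (-(L / 2))..(L / 2), gaussKernel a b s (s + h) := by
  rw [intervalIntegral.integral_comp_add_left (fun t => gaussKernel a b s t)]
  have := (gaussKernel_periodic_right (a := a) hb s).intervalIntegral_add_eq 0 (s + -(L / 2))
  rw [zero_add] at this
  rw [this]
  congr 1
  ring

/-- Călugăreanu's limit: the Gauss linking integral of a knot with its push-off tends to the sum of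
the writhe and the twist. -/
lemma tendsto_linkInt_pushOff (hL : 0 < L) (hf : ContDiff ℝ (⊤ : ℕ∞) f)
    (hper : Function.Periodic f L) (harc : ∀ s, ‖deriv f s‖ = 1) (hinj : InjOn f (Ico 0 L))
    (hu : ContDiff ℝ (⊤ : ℕ∞) u) (huper : Function.Periodic u L) (hunit : ∀ s, ‖u s‖ = 1)
    (hnormal : ∀ s, dot3 (u s) (deriv f s) = 0) {K ε₀ κ : ℝ} (hK : RibbonBounds f u K)
    (hε₀ : 0 < ε₀) (hε₁ : ε₀ ≤ 1) (hκ : 0 < κ)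
    (hlow : ∀ ε, 0 < ε → ε < ε₀ → ∀ s h : ℝ, |h| ≤ L / 2 →
      κ * √(h ^ 2 + ε ^ 2) ≤ ‖f s - (f (s + h) + ε • u (s + h))‖) :
    Tendsto (fun ε : ℝ => linkInt f (fun t => f t + ε • u t) L) (𝓝[>] 0)
      (𝓝 (writhe f L + twist f u L)) := by
  obtain ⟨df, hf1⟩ := contDiff_infty_iff_deriv.1 hf
  have hf2 := (contDiff_infty_iff_deriv.1 hf1).2
  obtain ⟨du, hu1⟩ := contDiff_infty_iff_deriv.1 hu
  have cf1 := hf1.continuous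
  have cf2 := hf2.continuous
  have cu := hu.continuous
  have cu1 := hu1.continuous
  obtain ⟨B, hB⟩ := hK.exists_abs_gaussRemainder_le (L := L) df du harc hunit hnormal hκ
  have hev : ∀ᶠ ε in 𝓝[>] (0:ℝ), 0 < ε ∧ ε < ε₀ := Ioo_mem_nhdsGT hε₀
  have habs : ∀ h, h ∈ uIoc (-(L / 2)) (L / 2) → |h| ≤ L / 2 := fun h hh => by
    rw [uIoc_of_le (by linarith)] at hh
    exact abs_le.2 ⟨hh.1.le, hh.2⟩
  have hbound : ∀ ε, 0 < ε → ε < ε₀ → ∀ s h : ℝ, |h| ≤ L / 2 → |gaussRemainder f u ε s h| ≤ B :=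
    fun ε h1 h2 => hB ε h1 (h2.le.trans hε₁) (hlow ε h1 h2)
  have hJ : ∀ ε, 0 < ε → ε < ε₀ →
      Continuous fun p : ℝ × ℝ => gaussKernel f (fun t => f t + ε • u t) p.1 (p.1 + p.2) :=
    fun ε h1 h2 => (continuous_gaussKernel (hf.of_le (by simp))
      ((hf.add (hu.const_smul ε)).of_le (by simp))
      (pushOff_disjoint hL hper huper h1 hκ (hlow ε h1 h2))).comp
      (f := fun p : ℝ × ℝ => (p.1, p.1 + p.2)) (by fun_prop)
  have hS : ∀ ε, 0 < ε → Continuous fun p : ℝ × ℝ =>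
      modelNumerator (deriv f p.1) (deriv (deriv f) p.1) (u p.1) (deriv u p.1) ε p.2 /
        √(p.2 ^ 2 + ε ^ 2) ^ 3 := fun ε h1 => by
    have hden : ∀ p : ℝ × ℝ, √(p.2 ^ 2 + ε ^ 2) ^ 3 ≠ 0 := fun p => by positivity
    simp only [modelNumerator, det3_eq]
    fun_prop (disch := assumption)
  have hR : ∀ ε, 0 < ε → ε < ε₀ →
      Continuous (Function.uncurry fun s h => gaussRemainder f u ε s h) :=
    fun ε h1 h2 => (hJ ε h1 h2).sub (hS ε h1)
  have hRs : ∀ ε, 0 < ε → ε < ε₀ → ∀ s, Continuous fun h => gaussRemainder f u ε s h :=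
    fun ε h1 h2 s => (hR ε h1 h2).comp (f := fun h => (s, h)) (by fun_prop)
  have hRint : ∀ ε, 0 < ε → ε < ε₀ →
      Continuous fun s => ∫ h in (-(L / 2))..(L / 2), gaussRemainder f u ε s h := fun ε h1 h2 =>
    intervalIntegral.continuous_parametric_intervalIntegral_of_continuous' (hR ε h1 h2) _ _
  have hinner : ∀ s, Tendsto (fun ε => ∫ h in (-(L / 2))..(L / 2), gaussRemainder f u ε s h)
      (𝓝[>] 0) (𝓝 (∫ t in (0:ℝ)..L, gaussKernel f f s t)) := by
    intro s
    rw [integral_gaussKernel_shift hper]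
    refine intervalIntegral.tendsto_integral_filter_of_dominated_convergence (fun _ => B) ?_ ?_
      intervalIntegrable_const ?_
    · filter_upwards [hev] with ε hε using (hRs ε hε.1 hε.2 s).aestronglyMeasurable
    · filter_upwards [hev] with ε hε
      exact ae_of_all _ fun h hh => hbound ε hε.1 hε.2 s h (habs h hh)
    · filter_upwards [compl_mem_ae_iff.2 (measure_singleton (0:ℝ))] with h h0 hh
      exact tendsto_gaussRemainder df du h0
        (apply_ne_apply_add hL hper hinj s h0 (habs h hh))
  have houter : Tendsto (fun ε => ∫ s in (0:ℝ)..L, ∫ h in (-(L / 2))..(L / 2),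
      gaussRemainder f u ε s h) (𝓝[>] 0)
      (𝓝 (∫ s in (0:ℝ)..L, ∫ t in (0:ℝ)..L, gaussKernel f f s t)) := by
    refine intervalIntegral.tendsto_integral_filter_of_dominated_convergence
      (fun _ => B * |L / 2 - -(L / 2)|) ?_ ?_ intervalIntegrable_const ?_
    · filter_upwards [hev] with ε hε using (hRint ε hε.1 hε.2).aestronglyMeasurable
    · filter_upwards [hev] with ε hε
      exact ae_of_all _ fun s _ => intervalIntegral.norm_integral_le_of_norm_le_const
        fun h hh => hbound ε hε.1 hε.2 s h (habs h hh)
    · exact ae_of_all _ fun s _ => hinner s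
  have hcoef : Tendsto (fun ε : ℝ => L / √((L / 2) ^ 2 + ε ^ 2)) (𝓝[>] 0) (𝓝 2) := by
    have hden : ∀ ε : ℝ, √((L / 2) ^ 2 + ε ^ 2) ≠ 0 := fun ε => by positivity
    have hc : Continuous fun ε : ℝ => L / √((L / 2) ^ 2 + ε ^ 2) := by
      fun_prop (disch := assumption)
    have e : L / √((L / 2) ^ 2 + (0:ℝ) ^ 2) = 2 := by
      rw [zero_pow two_ne_zero, add_zero, Real.sqrt_sq (by positivity)]
      field_simp
    have ht := hc.tendsto 0
    rw [e] at ht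
    exact ht.mono_left nhdsWithin_le_nhds
  have hτ : Continuous fun s => -det3 (deriv f s) (deriv u s) (u s) :=
    (cf1.det3 cu1 cu).neg
  have hsplit : ∀ ε, 0 < ε → ε < ε₀ → linkInt f (fun t => f t + ε • u t) L =
      1 / (4 * π) * ((∫ s in (0:ℝ)..L, ∫ h in (-(L / 2))..(L / 2), gaussRemainder f u ε s h) +
        L / √((L / 2) ^ 2 + ε ^ 2) * ∫ s in (0:ℝ)..L, -det3 (deriv f s) (deriv u s) (u s)) := by
    intro ε h1 h2
    have hgper : Function.Periodic (fun t => f t + ε • u t) L := fun t => by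
      simp only [hper t, huper t]
    have e : ∀ s, ∫ t in (0:ℝ)..L, gaussKernel f (fun t => f t + ε • u t) s t =
        (∫ h in (-(L / 2))..(L / 2), gaussRemainder f u ε s h) +
          L / √((L / 2) ^ 2 + ε ^ 2) * -det3 (deriv f s) (deriv u s) (u s) := by
      intro s
      have hSs : Continuous fun h => modelNumerator (deriv f s) (deriv (deriv f) s) (u s)
          (deriv u s) ε h / √(h ^ 2 + ε ^ 2) ^ 3 :=
        (hS ε h1).comp (f := fun h => (s, h)) (by fun_prop)
      rw [integral_gaussKernel_shift hgper,
        ← integral_model _ (deriv (deriv f) s) (u s) (deriv u s) h1 L,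
        ← intervalIntegral.integral_add ((hRs ε h1 h2 s).intervalIntegrable _ _)
          (hSs.intervalIntegrable _ _)]
      simp only [gaussRemainder, sub_add_cancel]
    change 1 / (4 * π) * (∫ s in (0:ℝ)..L, ∫ t in (0:ℝ)..L,
      gaussKernel f (fun t => f t + ε • u t) s t) = _
    simp only [e]
    rw [intervalIntegral.integral_add ((hRint ε h1 h2).intervalIntegrable _ _)
      ((hτ.const_mul _).intervalIntegrable _ _), intervalIntegral.integral_const_mul]
  have hlim := (houter.add (hcoef.mul_const
    (∫ s in (0:ℝ)..L, -det3 (deriv f s) (deriv u s) (u s)))).const_mul (1 / (4 * π))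
  have htarget : writhe f L + twist f u L =
      1 / (4 * π) * ((∫ s in (0:ℝ)..L, ∫ t in (0:ℝ)..L, gaussKernel f f s t) +
        2 * ∫ s in (0:ℝ)..L, -det3 (deriv f s) (deriv u s) (u s)) := by
    have e : ∀ s, dot3 (deriv u s) (cross3 ((‖deriv f s‖)⁻¹ • deriv f s) (u s)) =
        -det3 (deriv f s) (deriv u s) (u s) := fun s => by
      rw [harc, inv_one, one_smul]
      change det3 _ _ _ = _
      simp only [det3_eq]
      ring
    simp only [twist, e]
    change 1 / (4 * π) * (∫ s in (0:ℝ)..L, ∫ t in (0:ℝ)..L, gaussKernel f f s t) + _ = _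
    ring
  rw [htarget]
  refine hlim.congr' ?_
  filter_upwards [hev] with ε hε using (hsplit ε hε.1 hε.2).symm

end PushOff

/-- Călugăreanu–White formula `Lk = Wr + Tw`. For a framed knot
`(f, u)` and all sufficiently small `ε > 0`, the push-off `g_ε = f + ε u` is disjoint
from `f` and the Gauss linking integral of `f` and `g_ε` equals `Wr(f) + Tw(f, u)`;
in particular `Wr(f) + Tw(f, u)` is an integer. -/
theorem linking_eq_writhe_add_twist
    (f u : ℝ → E3) (L : ℝ) (hL : 0 < L)
    (hf : ContDiff ℝ (⊤ : ℕ∞) f) (hper : Function.Periodic f L)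
    (harc : ∀ s, ‖deriv f s‖ = 1) (hinj : Set.InjOn f (Set.Ico 0 L))
    (hu : ContDiff ℝ (⊤ : ℕ∞) u) (huper : Function.Periodic u L)
    (hunit : ∀ s, ‖u s‖ = 1) (hnormal : ∀ s, dot3 (u s) (deriv f s) = 0) :
    (∃ ε₀ > (0:ℝ), ∀ ε : ℝ, 0 < ε → ε < ε₀ →
      (∀ s t : ℝ, f s ≠ f t + ε • u t) ∧
      linkInt f (fun t => f t + ε • u t) L = writhe f L + twist f u L) ∧
    ∃ k : ℤ, writhe f L + twist f u L = (k : ℝ) := by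
  obtain ⟨K, hK⟩ := exists_ribbonBounds hL.ne' hf hper hu huper
  obtain ⟨ε₀, hε₀, hε₁, κ, hκ, hlow⟩ :=
    exists_pushOff_lower_bound hL hf.continuous hper harc hinj hunit hnormal hK
  have hdisj : ∀ ε, 0 < ε → ε < ε₀ → ∀ s t : ℝ, f s ≠ f t + ε • u t := fun ε h1 h2 =>
    pushOff_disjoint hL hper huper h1 hκ (hlow ε h1 h2)
  have hint : ∀ ε, 0 < ε → ε < ε₀ → ∃ k : ℤ, linkInt f (fun t => f t + ε • u t) L = k :=
    fun ε h1 h2 => exists_int_linkInt (hf.of_le (by simp))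
      ((hf.add (hu.const_smul ε)).of_le (by simp)) hL hper
      (fun t => by simp only [hper t, huper t]) (hdisj ε h1 h2)
  have hlim := tendsto_linkInt_pushOff hL hf hper harc hinj hu huper hunit hnormal hK hε₀ hε₁ hκ
    hlow
  have hev : ∀ᶠ ε in 𝓝[>] (0:ℝ), 0 < ε ∧ ε < ε₀ := Ioo_mem_nhdsGT hε₀
  obtain ⟨k, hk⟩ : writhe f L + twist f u L ∈ range ((↑) : ℤ → ℝ) :=
    Int.isClosedEmbedding_coe_real.isClosed_range.mem_of_tendsto hlim (by
      filter_upwards [hev] with ε hε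
      obtain ⟨n, hn⟩ := hint ε hε.1 hε.2
      exact ⟨n, hn.symm⟩)
  refine ⟨?_, k, hk.symm⟩
  rw [← hk] at hlim ⊢
  have hclose := hlim.eventually (Metric.ball_mem_nhds _ one_pos)
  obtain ⟨ε₁, hε₁', hsub⟩ := mem_nhdsGT_iff_exists_Ioo_subset.1 (hclose.and hev)
  refine ⟨ε₁, hε₁', fun ε h1 h2 => ?_⟩
  obtain ⟨hb, hε⟩ := hsub ⟨h1, h2⟩
  refine ⟨hdisj ε hε.1 hε.2, ?_⟩
  obtain ⟨n, hn⟩ := hint ε hε.1 hε.2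
  rw [hn, Int.dist_cast_real, Int.dist_eq] at hb
  rw [hn]
  have : |n - k| < 1 := by exact_mod_cast hb
  rw [sub_eq_zero.1 (Int.abs_lt_one_iff.1 this)]
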